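/- A typical compact set in K([0,1]^d) with d ≥ 2 intersects every (d−1)-dimensional affine hyperplane in at most d points; i.e., the set of compact E ⊆ [0,1]^d for which some hyperplane contains at least d+1 points of E is of first category in K([0,1]^d). -/

import Mathlib

/-- The unit cube `[0,1]^d` as a subtype of `ℝ^d`. -/
def UnitCube (d : ℕ) : Type := {x : EuclideanSpace ℝ (Fin d) // ∀ i, x i ∈ Set.Icc (0 : ℝ) 1}

noncomputable instance (d : ℕ) : MetricSpace (UnitCube d) :=
  Subtype.metricSpace

open Set Filter Topology

theorem cube_compact (d : ℕ) : CompactSpace (UnitCube d) := by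
  have h : IsCompact {x : EuclideanSpace ℝ (Fin d) | ∀ i, x i ∈ Set.Icc (0 : ℝ) 1} := by
    have h1 : IsCompact (Set.pi Set.univ (fun _ : Fin d => Set.Icc (0 : ℝ) 1)) :=
      isCompact_univ_pi (fun _ => isCompact_Icc)
    have h2 := h1.image (PiLp.continuous_toLp 2 (fun _ : Fin d => ℝ))
    convert h2 using 1
    ext x
    constructor
    · intro hx
      exact ⟨x.ofLp, fun i _ => hx i, rfl⟩
    · rintro ⟨y, hy, rfl⟩ i
      exact hy i trivial
  exact isCompact_iff_compactSpace.mp h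

/-- Homogeneous coordinates matrix. -/
def hmat {d : ℕ} (x : Fin (d + 1) → EuclideanSpace ℝ (Fin d)) :
    Matrix (Fin (d + 1)) (Fin (d + 1)) ℝ :=
  fun i j => (Fin.cons 1 (fun k => x i k) : Fin (d + 1) → ℝ) j

theorem affInd_of_det {d : ℕ} (x : Fin (d + 1) → EuclideanSpace ℝ (Fin d))
    (h : (hmat x).det ≠ 0) : AffineIndependent ℝ x := by
  rw [affineIndependent_iff_of_fintype]
  intro w hw hw2
  rw [Finset.weightedVSub_eq_linear_combination _ hw] at hw2
  have : w = 0 := by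
    apply Matrix.eq_zero_of_vecMul_eq_zero h
    funext j
    refine Fin.cases ?_ (fun k => ?_) j
    · simpa [Matrix.vecMul, dotProduct, hmat] using hw
    · have := congrArg (fun v : EuclideanSpace ℝ (Fin d) => v k) hw2
      simpa [Matrix.vecMul, dotProduct, hmat] using this
  intro i
  exact congrFun this i

theorem bad_finite {d : ℕ} (A B : Matrix (Fin (d + 1)) (Fin (d + 1)) ℝ) (hB : B.det ≠ 0) :
    {s : ℝ | ((1 - s) • A + s • B).det = 0}.Finite := by
  let M : Matrix (Fin (d + 1)) (Fin (d + 1)) (Polynomial ℝ) :=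
    fun i j => (1 - Polynomial.X) * Polynomial.C (A i j) + Polynomial.X * Polynomial.C (B i j)
  have hev : ∀ s, Polynomial.eval s M.det = ((1 - s) • A + s • B).det := by
    intro s
    rw [← Polynomial.coe_evalRingHom, RingHom.map_det]
    congr 1
    ext i j
    rw [RingHom.mapMatrix_apply, Matrix.map_apply]
    simp [M]
    ring
  have hM : M.det ≠ 0 := by
    intro h0
    have := hev 1
    rw [h0] at this
    simp at this
    exact hB this.symm
  refine (Polynomial.finite_setOfPred_isRoot hM).subset ?_
  intro s hs
  show Polynomial.eval s M.det = 0
  rw [hev]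
  exact hs

/-- The moment curve. -/
noncomputable def mom (d : ℕ) (t : ℝ) : EuclideanSpace ℝ (Fin d) :=
  WithLp.toLp 2 (fun k => t ^ ((k : ℕ) + 1))

theorem hmat_mom {d : ℕ} (t : Fin (d + 1) → ℝ) :
    hmat (fun i => mom d (t i)) = Matrix.vandermonde t := by
  ext i j
  refine Fin.cases ?_ (fun k => ?_) j <;> simp [hmat, mom, Matrix.vandermonde_apply]

theorem hmat_comb {d : ℕ} (x y : Fin (d + 1) → EuclideanSpace ℝ (Fin d)) (s : ℝ) :
    hmat (fun i => (1 - s) • x i + s • y i) = (1 - s) • hmat x + s • hmat y := by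
  ext i j
  refine Fin.cases ?_ (fun k => ?_) j <;> simp [hmat]

theorem perturb {d : ℕ} {ι : Type} [Finite ι] (p : ι → UnitCube d) {ε : ℝ} (hε : 0 < ε) :
    ∃ q : ι → UnitCube d, (∀ i, dist (q i) (p i) < ε) ∧
      ∀ σ : Fin (d + 1) → ι, Function.Injective σ → AffineIndependent ℝ (fun i => (q (σ i)).1) := by
  classical
  obtain ⟨n, ⟨e⟩⟩ := Finite.exists_equiv_fin ι
  let τ : ι → ℝ := fun i => 1 / (((e i : ℕ) : ℝ) + 1)
  have hτinj : Function.Injective τ := by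
    intro i j h
    simp only [τ, one_div, inv_inj, add_left_inj, Nat.cast_inj] at h
    exact e.injective (Fin.ext h)
  have hτ0 : ∀ i, 0 ≤ τ i := fun i => by positivity
  have hτ1 : ∀ i, τ i ≤ 1 := fun i => by
    simp only [τ]
    rw [div_le_one (by positivity)]
    linarith [Nat.cast_nonneg (α := ℝ) (e i : ℕ)]
  let q : ℝ → ι → EuclideanSpace ℝ (Fin d) := fun s i => (1 - s) • (p i).1 + s • mom d (τ i)
  have h1 : ∀ᶠ s in 𝓝[>] (0 : ℝ), ∀ i, dist (q s i) (p i).1 < ε := by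
    rw [eventually_all]
    intro i
    have hc : Continuous (fun s => dist (q s i) (p i).1) := by fun_prop
    have h0 : dist (q 0 i) (p i).1 < ε := by simpa [q] using hε
    exact nhdsWithin_le_nhds (hc.continuousAt.eventually_lt continuousAt_const h0)
  have h2 : ∀ᶠ s in 𝓝[>] (0 : ℝ), ∀ σ : Fin (d + 1) → ι, Function.Injective σ →
      (hmat (fun i => q s (σ i))).det ≠ 0 := by
    rw [eventually_all]
    intro σ
    by_cases hσ : Function.Injective σ
    swap
    · exact Eventually.of_forall fun _ h => absurd h hσ
    have hf := bad_finite (hmat (fun i => (p (σ i)).1)) (hmat (fun i => mom d (τ (σ i))))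
      (by
        rw [hmat_mom (fun i => τ (σ i))]
        exact Matrix.det_vandermonde_ne_zero_iff.mpr (hτinj.comp hσ))
    have h3 : ∀ᶠ s in 𝓝[≠] (0 : ℝ), s ∉ {s : ℝ | ((1 - s) • (hmat (fun i => (p (σ i)).1)) +
        s • (hmat (fun i => mom d (τ (σ i))))).det = 0} := by
      have := hf.subset (t := {s : ℝ | ((1 - s) • (hmat (fun i => (p (σ i)).1)) +
        s • (hmat (fun i => mom d (τ (σ i))))).det = 0} \ {0}) sdiff_subset
      have h4 := this.isClosed.isOpen_compl.mem_nhds (x := (0 : ℝ)) (by simp)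
      filter_upwards [nhdsWithin_le_nhds h4, self_mem_nhdsWithin] with s hs hs0 hs1
      exact hs ⟨hs1, hs0⟩
    have h5 := h3.filter_mono (nhdsGT_le_nhdsNE (0 : ℝ))
    filter_upwards [h5] with s hs _ hdet
    apply hs
    rw [hmat_comb] at hdet
    exact hdet
  have h3 : ∀ᶠ s in 𝓝[>] (0 : ℝ), s < 1 :=
    nhdsWithin_le_nhds (eventually_lt_nhds zero_lt_one)
  obtain ⟨s, ha, hb, hc, hd⟩ := (h1.and (h2.and (h3.and self_mem_nhdsWithin))).exists
  have hd : 0 < s := hd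
  refine ⟨fun i => ⟨q s i, fun k => ?_⟩, fun i => ha i, fun σ hσ => affInd_of_det _ (hb σ hσ)⟩
  have hp := (p i).2 k
  have hm : mom d (τ i) k ∈ Set.Icc (0 : ℝ) 1 :=
    ⟨pow_nonneg (hτ0 i) _, pow_le_one₀ (hτ0 i) (hτ1 i)⟩
  exact (convex_Icc (0 : ℝ) 1) hp hm (by linarith) hd.le (by ring)

theorem good_dense {d : ℕ} : Dense {E : TopologicalSpace.NonemptyCompacts (UnitCube d) |
      ∀ x : Fin (d + 1) → UnitCube d, Function.Injective x → (∀ i, x i ∈ E) →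
        AffineIndependent ℝ (fun i => (x i).1)} := by
  rw [Metric.dense_iff]
  intro E r hr
  obtain ⟨t, htE, htf, hcov⟩ := E.isCompact.finite_cover_balls (e := r / 4) (by positivity)
  have : Finite t := htf
  obtain ⟨n, ⟨e⟩⟩ := Finite.exists_equiv_fin t
  obtain ⟨q, hq, hqi⟩ := perturb (fun i : Fin n => (e.symm i).1) (ε := r / 4) (by positivity)
  have key1 : ∀ x ∈ (E : Set (UnitCube d)), ∃ y ∈ range q, dist x y ≤ r / 2 := by
    intro x hx
    obtain ⟨y, hy, hxy⟩ := mem_iUnion₂.mp (hcov hx)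
    refine ⟨q (e ⟨y, hy⟩), mem_range_self _, ?_⟩
    have h1 := hq (e ⟨y, hy⟩)
    simp only [Equiv.symm_apply_apply] at h1
    have h2 := dist_triangle_right x (q (e ⟨y, hy⟩)) y
    have h3 : dist x y < r / 4 := hxy
    linarith
  have key2 : ∀ x ∈ range q, ∃ y ∈ (E : Set (UnitCube d)), dist x y ≤ r / 2 := by
    rintro _ ⟨i, rfl⟩
    exact ⟨_, htE (e.symm i).2, by linarith [hq i]⟩
  have hne : (range q).Nonempty := by
    obtain ⟨x, hx⟩ := E.nonempty
    obtain ⟨y, hy, _⟩ := key1 x hx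
    exact ⟨y, hy⟩
  refine ⟨⟨⟨range q, (finite_range q).isCompact⟩, hne⟩, ?_, ?_⟩
  · rw [Metric.mem_ball, Metric.NonemptyCompacts.dist_eq]
    refine lt_of_le_of_lt (Metric.hausdorffDist_le_of_mem_dist (r := r / 2) (by positivity)
      key2 key1) (by linarith)
  · intro x hx hxE
    have hxE : ∀ i, x i ∈ range q := hxE
    choose σ hσ using hxE
    have hinj : Function.Injective σ := by
      intro i j h
      apply hx
      rw [← hσ i, ← hσ j, h]
    have := hqi σ hinj
    simpa only [hσ] using this

theorem isClosed_memNC {α : Type*} [MetricSpace α] :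
    IsClosed {P : TopologicalSpace.NonemptyCompacts α × α | P.2 ∈ P.1} := by
  have h0 : Continuous fun p : α × TopologicalSpace.NonemptyCompacts α =>
      Metric.infDist p.1 (p.2 : Set α) := Metric.lipschitz_infDist.continuous
  have h1 : IsClosed {P : α × TopologicalSpace.NonemptyCompacts α | P.1 ∈ P.2} := by
    convert isClosed_eq h0 (continuous_const (y := (0 : ℝ))) using 1
    ext P
    exact P.2.isCompact.isClosed.mem_iff_infDist_zero P.2.nonempty
  exact h1.preimage (f := fun P : TopologicalSpace.NonemptyCompacts α × α => (P.2, P.1))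
    (by fun_prop)

theorem bad_closed {d : ℕ} (δ : ℝ) :
    IsClosed {E : TopologicalSpace.NonemptyCompacts (UnitCube d) |
      ∃ x : Fin (d + 1) → UnitCube d, (∀ i j, i ≠ j → δ ≤ dist (x i) (x j)) ∧ (∀ i, x i ∈ E) ∧
        ¬ AffineIndependent ℝ (fun i => (x i).1)} := by
  have := cube_compact d
  have hmem : IsClosed {P : TopologicalSpace.NonemptyCompacts (UnitCube d) × UnitCube d |
      P.2 ∈ P.1} := isClosed_memNC
  have hval : Continuous (fun x : UnitCube d => x.1) := continuous_subtype_val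
  have hcl : IsClosed {P : TopologicalSpace.NonemptyCompacts (UnitCube d) ×
      (Fin (d + 1) → UnitCube d) | (∀ i j, i ≠ j → δ ≤ dist (P.2 i) (P.2 j)) ∧
        (∀ i, P.2 i ∈ P.1) ∧ ¬ AffineIndependent ℝ (fun i => (P.2 i).1)} := by
    refine IsClosed.inter ?_ (IsClosed.inter ?_ ?_)
    · show IsClosed {P : TopologicalSpace.NonemptyCompacts (UnitCube d) ×
        (Fin (d + 1) → UnitCube d) | ∀ i j, i ≠ j → δ ≤ dist (P.2 i) (P.2 j)}
      simp only [ofPred_forall]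
      refine isClosed_iInter fun i => isClosed_iInter fun j => isClosed_iInter fun _ => ?_
      exact isClosed_le (by fun_prop) (by fun_prop)
    · show IsClosed {P : TopologicalSpace.NonemptyCompacts (UnitCube d) ×
        (Fin (d + 1) → UnitCube d) | ∀ i, P.2 i ∈ P.1}
      simp only [ofPred_forall]
      refine isClosed_iInter fun i => ?_
      exact hmem.preimage (f := fun P : TopologicalSpace.NonemptyCompacts (UnitCube d) ×
        (Fin (d + 1) → UnitCube d) => (P.1, P.2 i)) (by fun_prop)
    · have ho : IsOpen {p : Fin (d + 1) → EuclideanSpace ℝ (Fin d) | AffineIndependent ℝ p} :=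
        isOpen_setOfPred_affineIndependent
      exact (ho.preimage (f := fun P : TopologicalSpace.NonemptyCompacts (UnitCube d) ×
        (Fin (d + 1) → UnitCube d) => fun i => (P.2 i).1) (by fun_prop)).isClosed_compl
  convert isClosedMap_fst_of_compactSpace _ hcl using 1
  ext E
  simp

theorem stmt7 (d : ℕ) (hd : 2 ≤ d) :
    IsMeagre {E : TopologicalSpace.NonemptyCompacts (UnitCube d) |
      ∃ x : Fin (d + 1) → UnitCube d, Function.Injective x ∧ (∀ i, x i ∈ E) ∧
        ¬ AffineIndependent ℝ (fun i => (x i).1)} := by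
  have hm : ∀ n : ℕ, IsMeagre {E : TopologicalSpace.NonemptyCompacts (UnitCube d) |
      ∃ x : Fin (d + 1) → UnitCube d, (∀ i j, i ≠ j → (1 / ((n : ℝ) + 1)) ≤ dist (x i) (x j)) ∧
        (∀ i, x i ∈ E) ∧ ¬ AffineIndependent ℝ (fun i => (x i).1)} := by
    intro n
    refine IsNowhereDense.isMeagre ?_
    refine (isClosed_isNowhereDense_iff_compl.mpr ⟨(bad_closed _).isOpen_compl, ?_⟩).2
    refine good_dense.mono ?_
    rintro E hE ⟨x, hx, hxE, hna⟩
    refine hna (hE x ?_ hxE)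
    intro i j hij
    by_contra hne
    have h1 := hx i j hne
    rw [hij, dist_self] at h1
    have h2 : (0 : ℝ) < 1 / ((n : ℝ) + 1) := by positivity
    linarith
  refine (isMeagre_iUnion hm).mono ?_
  rintro E ⟨x, hx, hxE, hna⟩
  have : ∀ᶠ n : ℕ in atTop, ∀ i j, i ≠ j → (1 / ((n : ℝ) + 1)) ≤ dist (x i) (x j) := by
    rw [eventually_all]
    intro i
    rw [eventually_all]
    intro j
    by_cases hij : i = j
    · exact Eventually.of_forall fun _ h => absurd hij h
    have hpos : 0 < dist (x i) (x j) := dist_pos.mpr (hx.ne hij)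
    filter_upwards [(tendsto_one_div_add_atTop_nhds_zero_nat (𝕜 := ℝ)).eventually_lt_const hpos]
      with n hn _
    exact hn.le
  obtain ⟨n, hn⟩ := this.exists
  exact mem_iUnion.mpr ⟨n, x, hn, hxE, hna⟩
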